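/- arXiv:1703.10922 — 4 statements merged into one kernel-verified Lean document; each statement's English description precedes it below -/
import Mathlib

section
/- Let V be a finite-dimensional real normed vector space, let m be a natural number, and let u_0, u_1, …, u_m : ℕ → V be sequences such that at least one of the sequences (u_j(k))_k is unbounded. Then there exists s ∈ (0,1] such that the sequence k ↦ u_0(k) + s·u_1(k) + s²·u_2(k) + ⋯ + sᵐ·u_m(k) is unbounded. -/
/-- If `A` is an invertible real matrix and every row combination `k ↦ ∑ l, A i l • u l k` is
bounded, then every sequence `u j` is bounded. -/
theorem bddAbove_norm_of_bddAbove_norm_matrix_smul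
    {V ι κ : Type*} [SeminormedAddCommGroup V] [NormedSpace ℝ V] [Fintype ι] [DecidableEq ι]
    {A : Matrix ι ι ℝ} (hA : IsUnit A.det) (u : ι → κ → V)
    (h : ∀ i, BddAbove (Set.range fun k => ‖∑ l, A i l • u l k‖)) (j : ι) :
    BddAbove (Set.range fun k => ‖u j k‖) := by
  choose C hC using h
  refine ⟨∑ i, ‖A⁻¹ j i‖ * C i, ?_⟩
  rintro _ ⟨k, rfl⟩
  have key : u j k = ∑ i, A⁻¹ j i • ∑ l, A i l • u l k := by
    simp_rw [Finset.smul_sum, smul_smul]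
    rw [Finset.sum_comm]
    simp_rw [← Finset.sum_smul, ← Matrix.mul_apply, Matrix.nonsing_inv_mul A hA,
      Matrix.one_apply, ite_smul, one_smul, zero_smul]
    simp
  calc ‖u j k‖ = ‖∑ i, A⁻¹ j i • ∑ l, A i l • u l k‖ := congrArg norm key
    _ ≤ ∑ i, ‖A⁻¹ j i • ∑ l, A i l • u l k‖ := norm_sum_le _ _
    _ ≤ ∑ i, ‖A⁻¹ j i‖ * C i := Finset.sum_le_sum fun i _ => by
      rw [norm_smul]
      exact mul_le_mul_of_nonneg_left (hC i ⟨k, rfl⟩) (norm_nonneg _)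

/-- If at least one of the sequences `u 0, …, u m : ℕ → V` in a finite-dimensional real
normed vector space is unbounded, then for a suitable `s ∈ (0,1]` the sequence
`k ↦ ∑ j, s ^ j • u j k` is unbounded. -/
theorem unbounded_polynomial_combination
    {V : Type*} [NormedAddCommGroup V] [NormedSpace ℝ V] [FiniteDimensional ℝ V]
    (m : ℕ) (u : Fin (m + 1) → ℕ → V)
    (h : ∃ j : Fin (m + 1), ¬ BddAbove (Set.range fun k => ‖u j k‖)) :
    ∃ s : ℝ, s ∈ Set.Ioc (0 : ℝ) 1 ∧
      ¬ BddAbove (Set.range fun k => ‖∑ j : Fin (m + 1), s ^ (j : ℕ) • u j k‖) := by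
  obtain ⟨j, hj⟩ := h
  by_contra! hbdd
  let v : Fin (m + 1) → ℝ := fun i => ((i : ℝ) + 1)⁻¹
  have hv : Function.Injective v := fun a b hab => by
    simpa [v, Fin.ext_iff] using hab
  refine hj (bddAbove_norm_of_bddAbove_norm_matrix_smul (A := Matrix.vandermonde v)
    (Matrix.det_vandermonde_ne_zero_iff.mpr hv).isUnit u (fun i => ?_) j)
  simpa only [Matrix.vandermonde_apply] using
    hbdd (v i) ⟨by positivity, inv_le_one_of_one_le₀ (by simp)⟩
end

section
/- Let E, F, W be finite-dimensional real normed vector spaces and let B : E × F → W be a bilinear map such that for every nonzero Y ∈ F there exists X ∈ E with B(X,Y) ≠ 0. If (Y_k) is an unbounded sequence in F, then there exists a sequence (ξ_k) in E converging to 0 such that the sequence (B(ξ_k, Y_k)) is unbounded in W. -/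
open Filter

/-- For an unbounded real sequence there are positive weights tending to `0` whose product with
the sequence is still unbounded. -/
theorem exists_pos_tendsto_zero_mul_unbounded {a : ℕ → ℝ} (ha : ¬ BddAbove (Set.range a)) :
    ∃ c : ℕ → ℝ, (∀ k, 0 < c k) ∧ Tendsto c atTop (nhds 0) ∧
      ∀ C : ℝ, ∃ k, C < c k * a k := by
  have hex : ∀ C : ℝ, ∃ k, C < a k := by
    simpa [not_bddAbove_iff] using ha
  have hM : Tendsto (fun k => partialSups a k) atTop atTop :=
    tendsto_atTop_atTop_of_monotone (partialSups a).monotone fun C =>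
      (hex C).imp fun k hk => hk.le.trans (le_partialSups a k)
  have hm : ∀ k, 0 < max (partialSups a k) 1 := fun k => lt_max_of_lt_right one_pos
  refine ⟨fun k => (√(max (partialSups a k) 1))⁻¹,
    fun k => inv_pos.2 (Real.sqrt_pos.2 (hm k)),
    (Real.tendsto_sqrt_atTop.comp
      (tendsto_atTop_mono (fun k => le_max_left _ _) hM)).inv_tendsto_atTop, fun C => ?_⟩
  classical
  -- At the first index exceeding a threshold, the running maximum equals the current term.
  have hthr := hex (max (C ^ 2) 1)
  obtain ⟨k, hk, hmin⟩ : ∃ k, max (C ^ 2) 1 < a k ∧ ∀ j < k, a j ≤ max (C ^ 2) 1 :=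
    ⟨Nat.find hthr, Nat.find_spec hthr, fun j hj => not_lt.1 (Nat.find_min hthr hj)⟩
  have hmax : partialSups a k = a k := by
    refine le_antisymm (partialSups_le a k _ fun j hj => ?_) (le_partialSups a k)
    rcases hj.lt_or_eq with h | rfl
    · exact (hmin j h).trans hk.le
    · exact le_rfl
  obtain ⟨hC, h1⟩ := max_lt_iff.1 hk
  refine ⟨k, ?_⟩
  beta_reduce
  rw [hmax, max_eq_left h1.le, mul_comm, ← div_eq_mul_inv, Real.div_sqrt]
  exact Real.lt_sqrt_of_sq_lt hC

/-- A bilinear map of finite-dimensional spaces that is nondegenerate in its second argument is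
bounded below, uniformly in that argument, on suitable vectors of norm at most one. -/
theorem exists_pos_forall_exists_norm_le_one_mul_norm_le
    {E F W : Type*}
    [NormedAddCommGroup E] [NormedSpace ℝ E] [FiniteDimensional ℝ E]
    [NormedAddCommGroup F] [NormedSpace ℝ F] [FiniteDimensional ℝ F]
    [NormedAddCommGroup W] [NormedSpace ℝ W]
    (B : E →ₗ[ℝ] F →ₗ[ℝ] W) (hB : ∀ Y : F, Y ≠ 0 → ∃ X : E, B X Y ≠ 0) :
    ∃ δ > 0, ∀ Y : F, ∃ X : E, ‖X‖ ≤ 1 ∧ δ * ‖Y‖ ≤ ‖B X Y‖ := by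
  let T : F →ₗ[ℝ] E →L[ℝ] W := LinearMap.toContinuousLinearMap.toLinearMap ∘ₗ B.flip
  have hker : LinearMap.ker T = ⊥ := by
    refine LinearMap.ker_eq_bot'.2 fun Y hY => ?_
    by_contra hne
    obtain ⟨X, hX⟩ := hB Y hne
    exact hX (DFunLike.congr_fun hY X)
  obtain ⟨K, hK, hT⟩ := T.exists_antilipschitzWith hker
  have hK' : (0 : ℝ) < K := hK
  refine ⟨(2 * K : ℝ)⁻¹, by positivity, fun Y => ?_⟩
  rcases eq_or_ne Y 0 with rfl | hne
  · exact ⟨0, by simp⟩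
  have hbound : ‖Y‖ ≤ K * ‖T Y‖ := by simpa using hT.le_mul_dist Y 0
  have hlt : (2 * K : ℝ)⁻¹ * ‖Y‖ < ‖T Y‖ := by
    have := norm_pos_iff.2 hne
    rw [inv_mul_lt_iff₀ (by positivity)]
    linarith
  obtain ⟨X, hX, hXY⟩ := (T Y).exists_lt_apply_of_lt_opNorm hlt
  exact ⟨X, hX.le, hXY.le⟩

/-- If `B : E × F → W` is a bilinear map between finite-dimensional real normed vector
spaces such that for every nonzero `Y` there is `X` with `B X Y ≠ 0`, and `(Y k)` is an
unbounded sequence in `F`, then there is a sequence `(ξ k)` in `E` tending to `0` such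
that `(B (ξ k) (Y k))` is unbounded in `W`. -/
theorem bilinear_nondegenerate_unbounded_image
    {E F W : Type*}
    [NormedAddCommGroup E] [NormedSpace ℝ E] [FiniteDimensional ℝ E]
    [NormedAddCommGroup F] [NormedSpace ℝ F] [FiniteDimensional ℝ F]
    [NormedAddCommGroup W] [NormedSpace ℝ W] [FiniteDimensional ℝ W]
    (B : E →ₗ[ℝ] F →ₗ[ℝ] W)
    (hB : ∀ Y : F, Y ≠ 0 → ∃ X : E, B X Y ≠ 0)
    (Y : ℕ → F)
    (hY : ¬ BddAbove (Set.range fun k => ‖Y k‖)) :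
    ∃ ξ : ℕ → E, Tendsto ξ atTop (nhds 0) ∧
      ¬ BddAbove (Set.range fun k => ‖B (ξ k) (Y k)‖) := by
  obtain ⟨δ, hδ, h⟩ := exists_pos_forall_exists_norm_le_one_mul_norm_le B hB
  choose X hX hXY using h
  obtain ⟨c, hc, hc0, hcY⟩ := exists_pos_tendsto_zero_mul_unbounded hY
  refine ⟨fun k => c k • X (Y k), ?_, ?_⟩
  · refine squeeze_zero_norm (fun k => ?_) hc0
    rw [norm_smul, Real.norm_of_nonneg (hc k).le]
    exact mul_le_of_le_one_right (hc k).le (hX _)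
  · rintro ⟨C, hC⟩
    obtain ⟨k, hk⟩ := hcY (C / δ)
    have hle : ‖B (c k • X (Y k)) (Y k)‖ ≤ C := hC ⟨k, rfl⟩
    rw [map_smul, LinearMap.smul_apply, norm_smul, Real.norm_of_nonneg (hc k).le] at hle
    rw [div_lt_iff₀ hδ] at hk
    have := mul_le_mul_of_nonneg_left (hXY (Y k)) (hc k).le
    linarith
end

section
/- Let R be an irreducible finite crystallographic root system with base Φ, let α ∈ Φ, and set Λ = Φ \ {α}. Suppose there exists a root λ all of whose coefficients in the base Φ are strictly positive, such that λ = m·α + μ where m ≥ 1 is the coefficient of λ on α and μ = λ − m·α is itself a root (lying in the span of Λ). Then α is a valence-one vertex of the Dynkin graph of Φ; that is, there is exactly one element β ∈ Λ with ⟨α, β^∨⟩ ≠ 0. -/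
open scoped RealInnerProductSpace

/-- The Cartan number `⟨β, γ^∨⟩ = 2(β,γ)/(γ,γ)` of two vectors in a real inner
product space. -/
noncomputable def cartanNum {V : Type*} [NormedAddCommGroup V] [InnerProductSpace ℝ V]
    (β γ : V) : ℝ :=
  2 * ⟪β, γ⟫ / ⟪γ, γ⟫

/-- The reflection of `β` in (the hyperplane orthogonal to) `γ`. -/
noncomputable def rootReflect {V : Type*} [NormedAddCommGroup V] [InnerProductSpace ℝ V]
    (γ β : V) : V :=
  β - cartanNum β γ • γ

/-- A finite crystallographic root system `R` in a real inner product space with a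
fixed base `Φ`, together with the (integral) coordinate function `coeff`, so that
`coeff β α` is the coefficient of the root `β` on the simple root `α`. -/
structure IsRootSystemWithBase {V : Type*} [NormedAddCommGroup V] [InnerProductSpace ℝ V]
    (R Φ : Finset V) (coeff : V → V → ℤ) : Prop where
  base_subset : Φ ⊆ R
  ne_zero : ∀ β ∈ R, β ≠ 0
  indep : LinearIndependent ℝ (fun x : (Φ : Set V) => (x : V))
  expand : ∀ β ∈ R, β = ∑ α ∈ Φ, (coeff β α : ℝ) • α
  sign : ∀ β ∈ R, (∀ α ∈ Φ, 0 ≤ coeff β α) ∨ (∀ α ∈ Φ, coeff β α ≤ 0)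
  crystallographic : ∀ β ∈ R, ∀ γ ∈ R, ∃ n : ℤ, cartanNum β γ = n
  reflect_mem : ∀ β ∈ R, ∀ γ ∈ R, rootReflect γ β ∈ R

/-- A root system is irreducible if it cannot be partitioned into two nonempty
mutually orthogonal subsets. -/
def IsIrreducibleRootSystem {V : Type*} [NormedAddCommGroup V] [InnerProductSpace ℝ V]
    (R : Finset V) : Prop :=
  ¬ ∃ R₁ R₂ : Set V, R₁.Nonempty ∧ R₂.Nonempty ∧ (R : Set V) = R₁ ∪ R₂ ∧
      ∀ β ∈ R₁, ∀ γ ∈ R₂, ⟪β, γ⟫ = (0 : ℝ)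

namespace IsRootSystemWithBase

variable {V : Type*} [NormedAddCommGroup V] [InnerProductSpace ℝ V]
  {R Φ : Finset V} {coeff : V → V → ℤ}

/-- The coordinate of a root on a simple root extends to a linear functional on `V`. -/
lemma exists_coord (h : IsRootSystemWithBase R Φ coeff) :
    ∃ f : V → V →ₗ[ℝ] ℝ, (∀ γ ∈ Φ, f γ γ = 1) ∧
      (∀ γ ∈ Φ, ∀ δ ∈ Φ, δ ≠ γ → f γ δ = 0) ∧
      ∀ γ ∈ Φ, ∀ β ∈ R, f γ β = coeff β γ := by
  classical
  have key : ∀ γ : V, ∃ g : V →ₗ[ℝ] ℝ, ∀ δ ∈ Φ, g δ = if δ = γ then 1 else 0 := by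
    intro γ
    have hli : LinearIndepOn ℝ id (Φ : Set V) := h.indep
    let b := Module.Basis.extend hli
    refine ⟨b.constr ℝ fun x => if (x : V) = γ then 1 else 0, fun δ hδ => ?_⟩
    have hmem : δ ∈ hli.extend (Set.subset_univ _) :=
      hli.subset_extend (Set.subset_univ _) hδ
    have hb : b ⟨δ, hmem⟩ = δ := Module.Basis.extend_apply_self hli ⟨δ, hmem⟩
    have := b.constr_basis ℝ (fun x => if (x : V) = γ then (1 : ℝ) else 0) ⟨δ, hmem⟩
    rwa [hb] at this
  choose f hf using key
  refine ⟨f, fun γ hγ => by simp [hf γ γ hγ], fun γ _ δ hδ hne => by simp [hf γ δ hδ, hne],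
    fun γ hγ β hβ => ?_⟩
  conv_lhs => rw [h.expand β hβ]
  rw [map_sum, Finset.sum_eq_single_of_mem γ hγ]
  · simp [hf γ γ hγ]
  · intro δ hδ hne
    simp [hf γ δ hδ, hne]

lemma inner_self_pos (h : IsRootSystemWithBase R Φ coeff) {β : V} (hβ : β ∈ R) :
    0 < ⟪β, β⟫ :=
  real_inner_self_pos.2 (h.ne_zero β hβ)

lemma inner_eq_sum (h : IsRootSystemWithBase R Φ coeff) {β : V} (hβ : β ∈ R) (x : V) :
    ⟪β, x⟫ = ∑ γ ∈ Φ, (coeff β γ : ℝ) * ⟪γ, x⟫ := by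
  conv_lhs => rw [h.expand β hβ]
  simp [sum_inner, real_inner_smul_left]

lemma inner_nonpos_of_ne (h : IsRootSystemWithBase R Φ coeff) {γ δ : V} (hγ : γ ∈ Φ)
    (hδ : δ ∈ Φ) (hne : γ ≠ δ) : ⟪γ, δ⟫ ≤ 0 := by
  obtain ⟨f, hf1, hf0, hf⟩ := h.exists_coord
  have hr := h.reflect_mem γ (h.base_subset hγ) δ (h.base_subset hδ)
  have hδpos := h.inner_self_pos (h.base_subset hδ)
  have e1 := hf γ hγ _ hr
  have e2 := hf δ hδ _ hr
  simp only [rootReflect, map_sub, map_smul, smul_eq_mul, hf1 γ hγ, hf1 δ hδ,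
    hf0 γ hγ δ hδ hne.symm, hf0 δ hδ γ hγ hne] at e1 e2
  by_contra! hlt
  have hc : 0 < cartanNum γ δ := by unfold cartanNum; positivity
  rcases h.sign _ hr with hs | hs
  · have : (0 : ℝ) ≤ _ := Int.cast_nonneg (hs δ hδ)
    simp only [rootReflect] at this
    linarith
  · have : _ ≤ (0 : ℝ) := Int.cast_nonpos.2 (hs γ hγ)
    simp only [rootReflect] at this
    linarith

/-- Two non-orthogonal roots make an angle whose cosine is at least `1 / 2` in absolute value. -/
lemma norm_mul_norm_le_two_mul_abs_inner (h : IsRootSystemWithBase R Φ coeff) {β γ : V}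
    (hβ : β ∈ R) (hγ : γ ∈ R) (hne : ⟪β, γ⟫ ≠ 0) : ‖β‖ * ‖γ‖ ≤ 2 * |⟪β, γ⟫| := by
  obtain ⟨p, hp⟩ := h.crystallographic β hβ γ hγ
  obtain ⟨q, hq⟩ := h.crystallographic γ hγ β hβ
  have hβ0 := h.inner_self_pos hβ
  have hγ0 := h.inner_self_pos hγ
  unfold cartanNum at hp hq
  rw [real_inner_comm] at hq
  have hprod : ((p * q : ℤ) : ℝ) * (⟪β, β⟫ * ⟪γ, γ⟫) = (2 * ⟪β, γ⟫) ^ 2 := by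
    push_cast
    rw [← hp, ← hq]
    field_simp
  have hpq : 0 < p * q := by
    have : (0 : ℝ) < ((p * q : ℤ) : ℝ) := by
      have h2 : 0 < (2 * ⟪β, γ⟫) ^ 2 := by positivity
      rw [← hprod] at h2
      exact pos_of_mul_pos_left h2 (by positivity)
    exact_mod_cast this
  have hpq1 : (1 : ℝ) ≤ ((p * q : ℤ) : ℝ) := by exact_mod_cast hpq
  have hsq : (‖β‖ * ‖γ‖) ^ 2 ≤ (2 * |⟪β, γ⟫|) ^ 2 := by
    rw [mul_pow 2 |_|, sq_abs, ← mul_pow, ← hprod, mul_pow, ← real_inner_self_eq_norm_sq,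
      ← real_inner_self_eq_norm_sq]
    exact le_mul_of_one_le_left (by positivity) hpq1
  exact le_of_sq_le_sq hsq (by positivity)

/-- The coroot of `ν` has integral coordinates with respect to the simple coroots. -/
def HasIntegralCoroot (R Φ : Finset V) (coeff : V → V → ℤ) (ν : V) : Prop :=
  ν ∈ R ∧ ∀ γ ∈ Φ, ∃ n : ℤ, (coeff ν γ : ℝ) * ⟪γ, γ⟫ = n * ⟪ν, ν⟫

lemma hasIntegralCoroot_of_mem_base (h : IsRootSystemWithBase R Φ coeff) {δ : V} (hδ : δ ∈ Φ) :
    HasIntegralCoroot R Φ coeff δ := by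
  obtain ⟨f, hf1, hf0, hf⟩ := h.exists_coord
  refine ⟨h.base_subset hδ, fun γ hγ => ?_⟩
  rw [← hf γ hγ δ (h.base_subset hδ)]
  by_cases hne : δ = γ
  · subst hne
    exact ⟨1, by simp [hf1 δ hδ]⟩
  · exact ⟨0, by simp [hf0 γ hγ δ hδ hne]⟩

lemma inner_rootReflect_self {γ : V} (hγ : γ ≠ 0) (β : V) :
    ⟪rootReflect γ β, rootReflect γ β⟫ = ⟪β, β⟫ := by
  have hγ0 : ⟪γ, γ⟫ ≠ 0 := inner_self_ne_zero.2 hγ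
  simp only [rootReflect, cartanNum, inner_sub_left, inner_sub_right, real_inner_smul_left,
    real_inner_smul_right, real_inner_comm γ β]
  field_simp
  ring

lemma rootReflect_rootReflect {γ : V} (hγ : γ ≠ 0) (β : V) :
    rootReflect γ (rootReflect γ β) = β := by
  have hγ0 : ⟪γ, γ⟫ ≠ 0 := inner_self_ne_zero.2 hγ
  have : cartanNum (rootReflect γ β) γ = -cartanNum β γ := by
    simp only [rootReflect, cartanNum, inner_sub_left, real_inner_smul_left]
    field_simp
    ring
  rw [rootReflect, this, rootReflect]
  module

lemma rootReflect_smul (γ : V) (k : ℝ) (β : V) :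
    rootReflect γ (k • β) = k • rootReflect γ β := by
  simp only [rootReflect, cartanNum, real_inner_smul_left]
  module

lemma HasIntegralCoroot.rootReflect (h : IsRootSystemWithBase R Φ coeff) {ν δ : V}
    (hν : HasIntegralCoroot R Φ coeff ν) (hδ : δ ∈ Φ) :
    HasIntegralCoroot R Φ coeff (rootReflect δ ν) := by
  obtain ⟨f, hf1, hf0, hf⟩ := h.exists_coord
  have hδR := h.base_subset hδ
  have hr := h.reflect_mem ν hν.1 δ hδR
  have hδ0 := (h.inner_self_pos hδR).ne'
  have hν0 := (h.inner_self_pos hν.1).ne'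
  refine ⟨hr, fun γ hγ => ?_⟩
  obtain ⟨n, hn⟩ := hν.2 γ hγ
  rw [inner_rootReflect_self (h.ne_zero δ hδR), ← hf γ hγ _ hr]
  by_cases hne : δ = γ
  · subst hne
    obtain ⟨q, hq⟩ := h.crystallographic δ hδR ν hν.1
    refine ⟨n - q, ?_⟩
    push_cast
    rw [sub_mul, ← hn, ← hq, ← hf δ hδ ν hν.1]
    simp only [_root_.rootReflect, cartanNum, map_sub, map_smul, smul_eq_mul, hf1 δ hδ,
      real_inner_comm ν δ]
    field_simp
  · refine ⟨n, ?_⟩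
    simpa only [_root_.rootReflect, map_sub, map_smul, hf0 γ hγ δ hδ hne, hf γ hγ ν hν.1,
      smul_zero, sub_zero] using hn

/-- Every positive root is a positive integral multiple of a root whose coroot is integral. -/
lemma exists_eq_smul_hasIntegralCoroot (h : IsRootSystemWithBase R Φ coeff) {μ : V}
    (hμ : μ ∈ R) (hpos : ∀ γ ∈ Φ, 0 ≤ coeff μ γ) :
    ∃ (k : ℤ) (ν : V), HasIntegralCoroot R Φ coeff ν ∧ μ = (k : ℝ) • ν := by
  obtain ⟨f, hf1, hf0, hf⟩ := h.exists_coord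
  induction hN : (∑ γ ∈ Φ, coeff μ γ).toNat using Nat.strong_induction_on generalizing μ with
  | _ N ih =>
    subst hN
    obtain ⟨δ, hδ, hδμ⟩ : ∃ δ ∈ Φ, 0 < ⟪δ, μ⟫ := by
      by_contra! hcon
      have := h.inner_self_pos hμ
      rw [h.inner_eq_sum hμ] at this
      refine this.not_ge (Finset.sum_nonpos fun γ hγ => ?_)
      exact mul_nonpos_of_nonneg_of_nonpos (Int.cast_nonneg (hpos γ hγ)) (hcon γ hγ)
    have hδR := h.base_subset hδ
    have hr := h.reflect_mem μ hμ δ hδR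
    have hδ0 := h.inner_self_pos hδR
    have hother : ∀ γ ∈ Φ, δ ≠ γ → coeff (rootReflect δ μ) γ = coeff μ γ := by
      intro γ hγ hne
      have e := hf γ hγ _ hr
      simp only [rootReflect, map_sub, map_smul, hf0 γ hγ δ hδ hne, hf γ hγ μ hμ, smul_zero,
        sub_zero] at e
      exact_mod_cast e.symm
    rcases h.sign _ hr with hs | hs
    · have hlt : coeff (rootReflect δ μ) δ < coeff μ δ := by
        have e := hf δ hδ _ hr
        simp only [map_sub, map_smul, hf1 δ hδ, hf δ hδ μ hμ, rootReflect] at e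
        have hc : 0 < cartanNum μ δ := by
          unfold cartanNum
          rw [real_inner_comm]
          positivity
        rw [smul_eq_mul, mul_one] at e
        have : (coeff (rootReflect δ μ) δ : ℝ) < coeff μ δ := by
          simp only [rootReflect]
          linarith
        exact_mod_cast this
      have hsum : ∑ γ ∈ Φ, coeff (rootReflect δ μ) γ < ∑ γ ∈ Φ, coeff μ γ := by
        refine Finset.sum_lt_sum (fun γ hγ => ?_) ⟨δ, hδ, hlt⟩
        by_cases hne : δ = γ
        · exact hne ▸ hlt.le
        · exact (hother γ hγ hne).le
      have hnn : 0 ≤ ∑ γ ∈ Φ, coeff (rootReflect δ μ) γ := Finset.sum_nonneg hs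
      obtain ⟨k, ν, hν, hk⟩ := ih _ (by omega) hr hs rfl
      refine ⟨k, rootReflect δ ν, hν.rootReflect h hδ, ?_⟩
      rw [← rootReflect_smul, ← hk, rootReflect_rootReflect (h.ne_zero δ hδR)]
    · refine ⟨coeff μ δ, δ, h.hasIntegralCoroot_of_mem_base hδ, ?_⟩
      conv_lhs => rw [h.expand μ hμ]
      refine Finset.sum_eq_single_of_mem δ hδ fun γ hγ hne => ?_
      have h0 : coeff μ γ = 0 :=
        le_antisymm (hother γ hγ hne.symm ▸ hs γ hγ) (hpos γ hγ)
      simp [h0]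

/-- Each nonzero component of a positive root along a simple root is at least as long as the
root itself. -/
lemma norm_le_coeff_mul_norm (h : IsRootSystemWithBase R Φ coeff) {μ : V} (hμ : μ ∈ R)
    (hpos : ∀ γ ∈ Φ, 0 ≤ coeff μ γ) {γ : V} (hγ : γ ∈ Φ) (hc : 0 < coeff μ γ) :
    ‖μ‖ ≤ coeff μ γ * ‖γ‖ := by
  obtain ⟨f, -, -, hf⟩ := h.exists_coord
  obtain ⟨k, ν, hν, rfl⟩ := h.exists_eq_smul_hasIntegralCoroot hμ hpos
  obtain ⟨n, hn⟩ := hν.2 γ hγ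
  have hc' : (0 : ℝ) < coeff ((k : ℝ) • ν) γ := Int.cast_pos.2 hc
  have e : (coeff ((k : ℝ) • ν) γ : ℝ) = k * coeff ν γ := by
    rw [← hf γ hγ _ hμ, ← hf γ hγ _ hν.1]
    simp
  have hc0 : coeff ν γ ≠ 0 := by
    intro h0
    simp [e, h0] at hc'
  have hγ0 := h.inner_self_pos (h.base_subset hγ)
  have hν0 := h.inner_self_pos hν.1
  have hmul : 0 < coeff ν γ * n := by
    have h1 : ((coeff ν γ * n : ℤ) : ℝ) * ⟪ν, ν⟫ = (coeff ν γ : ℝ) ^ 2 * ⟪γ, γ⟫ := by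
      push_cast
      rw [mul_assoc, ← hn]
      ring
    have h2 : 0 < ((coeff ν γ * n : ℤ) : ℝ) * ⟪ν, ν⟫ := by
      rw [h1]
      have : (coeff ν γ : ℝ) ≠ 0 := by exact_mod_cast hc0
      positivity
    exact_mod_cast pos_of_mul_pos_left h2 hν0.le
  have hmul1 : (1 : ℝ) ≤ coeff ν γ * n := by exact_mod_cast hmul
  have hsq : ‖(k : ℝ) • ν‖ ^ 2 ≤ (coeff ((k : ℝ) • ν) γ * ‖γ‖) ^ 2 := by
    rw [e, norm_smul, mul_pow, mul_pow, Real.norm_eq_abs, sq_abs, mul_pow,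
      ← real_inner_self_eq_norm_sq, ← real_inner_self_eq_norm_sq, mul_assoc]
    refine mul_le_mul_of_nonneg_left ?_ (sq_nonneg _)
    calc ⟪ν, ν⟫ ≤ (coeff ν γ * n) * ⟪ν, ν⟫ := le_mul_of_one_le_left hν0.le hmul1
      _ = (coeff ν γ : ℝ) ^ 2 * ⟪γ, γ⟫ := by rw [mul_assoc, ← hn]; ring
  exact le_of_sq_le_sq hsq (by positivity)

/-- A simple root outside the support of a positive root `μ` is adjacent to at most one simple
root in the support of `μ`. -/
lemma eq_of_inner_ne_zero (h : IsRootSystemWithBase R Φ coeff) {μ : V} (hμ : μ ∈ R)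
    (hpos : ∀ γ ∈ Φ, 0 ≤ coeff μ γ) {α β γ : V} (hα : α ∈ Φ) (hα0 : coeff μ α = 0)
    (hβ : β ∈ Φ) (hγ : γ ∈ Φ) (hβμ : 0 < coeff μ β) (hγμ : 0 < coeff μ γ)
    (hβα : ⟪β, α⟫ ≠ 0) (hγα : ⟪γ, α⟫ ≠ 0) : β = γ := by
  classical
  obtain ⟨f, hf1, hf0, hf⟩ := h.exists_coord
  by_contra hne
  have hαn : 0 < ‖α‖ := norm_pos_iff.2 (h.ne_zero α (h.base_subset hα))
  have hμn : 0 < ‖μ‖ := norm_pos_iff.2 (h.ne_zero μ hμ)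
  have bound : ∀ δ ∈ Φ, 0 < coeff μ δ → ⟪δ, α⟫ ≠ 0 →
      (coeff μ δ : ℝ) * ⟪δ, α⟫ ≤ -(‖μ‖ * ‖α‖ / 2) := by
    intro δ hδ hδμ hδα
    have hδne : δ ≠ α := by
      rintro rfl
      omega
    have h1 := h.norm_mul_norm_le_two_mul_abs_inner (h.base_subset hδ) (h.base_subset hα) hδα
    rw [abs_of_nonpos (h.inner_nonpos_of_ne hδ hα hδne)] at h1
    have h2 := h.norm_le_coeff_mul_norm hμ hpos hδ hδμ
    have h3 : (0 : ℝ) < coeff μ δ := Int.cast_pos.2 hδμ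
    nlinarith [mul_le_mul_of_nonneg_left h1 h3.le, mul_le_mul_of_nonneg_right h2 hαn.le]
  have hterm : ∀ δ ∈ Φ, (coeff μ δ : ℝ) * ⟪δ, α⟫ ≤ 0 := by
    intro δ hδ
    by_cases hδα : δ = α
    · simp [hδα, hα0]
    · exact mul_nonpos_of_nonneg_of_nonpos (Int.cast_nonneg (hpos δ hδ))
        (h.inner_nonpos_of_ne hδ hα hδα)
  have hinner : ⟪μ, α⟫ ≤ -(‖μ‖ * ‖α‖) := by
    have hsub : ({β, γ} : Finset V) ⊆ Φ := by
      simp [Finset.insert_subset_iff, hβ, hγ]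
    rw [h.inner_eq_sum hμ, ← Finset.sum_sdiff hsub, Finset.sum_pair hne]
    have := Finset.sum_nonpos fun δ (hδ : δ ∈ Φ \ {β, γ}) => hterm δ (Finset.sdiff_subset hδ)
    linarith [bound β hβ hβμ hβα, bound γ hγ hγμ hγα]
  have hzero : ‖α‖ • μ + ‖μ‖ • α = 0 := by
    refine (inner_self_eq_zero (𝕜 := ℝ)).1 (le_antisymm ?_ real_inner_self_nonneg)
    simp only [inner_add_left, inner_add_right, real_inner_smul_left, real_inner_smul_right,
      real_inner_comm μ α, real_inner_self_eq_norm_sq, norm_smul, norm_norm]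
    nlinarith [mul_le_mul_of_nonneg_left hinner (mul_pos hαn hμn).le]
  have := congrArg (f α) hzero
  simp [hf1 α hα, hf α hα μ hμ, hα0, hμn.ne'] at this

end IsRootSystemWithBase

/-- In an irreducible root system, if there is a root `λ` with all coefficients
strictly positive such that `λ = m • α + μ` with `μ = λ - m • α` itself a root (where
`m` is the coefficient of `λ` on the simple root `α`), then `α` is a valence-one
vertex of the Dynkin graph: exactly one simple root `β ≠ α` has `⟨α, β^∨⟩ ≠ 0`. -/
theorem valence_one_of_maximal_root_decomposition
    {V : Type*} [NormedAddCommGroup V] [InnerProductSpace ℝ V] [FiniteDimensional ℝ V]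
    {R Φ : Finset V} {coeff : V → V → ℤ}
    (hRS : IsRootSystemWithBase R Φ coeff)
    (hirr : IsIrreducibleRootSystem R)
    (α : V) (hα : α ∈ Φ)
    (lam : V) (hlam : lam ∈ R)
    (hpos : ∀ γ ∈ Φ, 0 < coeff lam γ)
    (hμ : lam - (coeff lam α : ℝ) • α ∈ R) :
    ∃! β : V, β ∈ Φ ∧ β ≠ α ∧ cartanNum α β ≠ 0 := by
  obtain ⟨f, hf1, hf0, hf⟩ := hRS.exists_coord
  set m := coeff lam α
  obtain ⟨μ, hμdef⟩ : ∃ μ, μ = lam - (m : ℝ) • α := ⟨_, rfl⟩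
  rw [← hμdef] at hμ
  have hfμ : ∀ γ, f γ μ = f γ lam - m * f γ α := fun γ => by simp [hμdef]
  have hαR := hRS.base_subset hα
  have hm : (0 : ℝ) < m := Int.cast_pos.2 (hpos α hα)
  have hμα : coeff μ α = 0 := by
    have e := hf α hα μ hμ
    rw [hfμ, hf1 α hα, hf α hα lam hlam, mul_one, sub_self] at e
    exact_mod_cast e.symm
  have hμγ : ∀ γ ∈ Φ, γ ≠ α → 0 < coeff μ γ := by
    intro γ hγ hne
    have e := hf γ hγ μ hμ
    rw [hfμ, hf0 γ hγ α hα hne.symm, hf γ hγ lam hlam, mul_zero, sub_zero] at e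
    have e' : coeff lam γ = coeff μ γ := by exact_mod_cast e
    exact e' ▸ hpos γ hγ
  have hμpos : ∀ γ ∈ Φ, 0 ≤ coeff μ γ := by
    intro γ hγ
    by_cases hne : γ = α
    · rw [hne, hμα]
    · exact (hμγ γ hγ hne).le
  have hinner : ∀ γ, cartanNum α γ ≠ 0 → ⟪γ, α⟫ ≠ 0 := by
    intro γ hγ h0
    rw [real_inner_comm] at h0
    simp [cartanNum, h0] at hγ
  refine existsUnique_of_exists_of_unique ?_ ?_
  · by_contra! hcon
    have horth : ⟪μ, α⟫ = 0 := by
      rw [hRS.inner_eq_sum hμ]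
      refine Finset.sum_eq_zero fun γ hγ => ?_
      by_cases hne : γ = α
      · simp [hne, hμα]
      · have hγ0 := (hRS.inner_self_pos (hRS.base_subset hγ)).ne'
        have h0 := hcon γ hγ hne
        rw [cartanNum, div_eq_zero_iff, or_iff_left hγ0, real_inner_comm] at h0
        simp only [mul_eq_zero, OfNat.ofNat_ne_zero, false_or] at h0
        rw [h0, mul_zero]
    obtain ⟨γ, hγ, hne⟩ : ∃ γ ∈ Φ, γ ≠ α := by
      by_contra! hall
      refine hRS.ne_zero μ hμ ?_
      rw [hRS.expand μ hμ]
      refine Finset.sum_eq_zero fun γ hγ => ?_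
      rw [hall γ hγ, hμα, Int.cast_zero, zero_smul]
    have hα0 := (hRS.inner_self_pos hαR).ne'
    have hrefl : rootReflect α lam = μ - (m : ℝ) • α := by
      have hlamμ : lam = μ + (m : ℝ) • α := by rw [hμdef]; abel
      have hc : cartanNum lam α = 2 * m := by
        rw [cartanNum, hlamμ, inner_add_left, horth, real_inner_smul_left]
        field_simp
        ring
      rw [rootReflect, hc, hμdef]
      module
    have hr := hRS.reflect_mem lam hlam α hαR
    rw [hrefl] at hr
    have e1 := hf α hα _ hr
    have e2 := hf γ hγ _ hr
    rw [map_sub, map_smul, hf α hα μ hμ, hμα, hf1 α hα] at e1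
    rw [map_sub, map_smul, hf γ hγ μ hμ, hf0 γ hγ α hα hne.symm, smul_zero, sub_zero] at e2
    have h2 : (0 : ℝ) < coeff μ γ := Int.cast_pos.2 (hμγ γ hγ hne)
    rw [Int.cast_zero, smul_eq_mul, mul_one, zero_sub] at e1
    rcases hRS.sign _ hr with hs | hs
    · have := Int.cast_nonneg (R := ℝ) (hs α hα)
      linarith
    · have := Int.cast_nonpos (R := ℝ) |>.2 (hs γ hγ)
      linarith
  · rintro β γ ⟨hβ, hβα, hβc⟩ ⟨hγ, hγα, hγc⟩
    exact hRS.eq_of_inner_ne_zero hμ hμpos hα hμα hβ hγ (hμγ β hβ hβα) (hμγ γ hγ hγα)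
      (hinner β hβc) (hinner γ hγc)
end

section
/- Let K be a field of characteristic zero, let L be a finite-dimensional semisimple Lie algebra over K (i.e., with nondegenerate Killing form), and let H be a splitting Cartan subalgebra of L. If α, ν, and ν + α are roots of (L, H), then for every nonzero Y in the root space L_{ν+α} there exists X in the root space L_{−α} such that ⁅X, Y⁆ ≠ 0; in particular, ⁅L_{−α}, L_{ν+α}⁆ ≠ 0. -/
open LieModule LieAlgebra LieAlgebra.IsKilling in
/-- If `β` and `β - α` are weights, with `α` and `β` nonzero, then some element of the root space
of `-α` acts injectively on the root space of `β`. -/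
lemma LieAlgebra.IsKilling.exists_mem_rootSpace_neg_forall_lie_ne_zero
    {K L : Type*} [Field K] [CharZero K] [LieRing L] [LieAlgebra K L]
    [FiniteDimensional K L] [IsKilling K L]
    {H : LieSubalgebra K L} [H.IsCartanSubalgebra] [IsTriangularizable K H L]
    {α β : Weight K H L} (hα : α.IsNonZero) (hβ : β.IsNonZero)
    (hβα : rootSpace H (-⇑α + ⇑β) ≠ ⊥) :
    ∃ x ∈ rootSpace H (-⇑α), ∀ y ∈ rootSpace H β, y ≠ 0 → ⁅x, y⁆ ≠ 0 := by
  obtain ⟨h, e, f, isSl2, he, hf⟩ := exists_isSl2Triple_of_weight_isNonZero hα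
  obtain rfl := isSl2.h_eq_coroot hα he hf
  refine ⟨f, hf, fun y hy hy₀ hfy ↦ ?_⟩
  obtain ⟨z, hz, hz₀⟩ := (chainTop α β).exists_ne_zero
  have prim : isSl2.HasPrimitiveVectorWith z (chainLength α β : K) :=
    have := lie_mem_genWeightSpace_of_mem_genWeightSpace he hz
    ⟨hz₀, (chainLength_smul _ _ hz).symm, by rwa [genWeightSpace_add_chainTop _ _ hα] at this⟩
  have hbot : (1 : ℤ) ≤ chainBotCoeff α β :=
    le_chainBotCoeff_of_rootSpace_ne_top α β hα 1 (by simpa using hβα)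
  have hle : chainTopCoeff α β + 1 ≤ chainLength α β := by
    have := chainTopCoeff_add_chainBotCoeff α β
    lia
  have hmem : (toEnd K L L f ^ chainTopCoeff α β) z ∈ rootSpace H β := by
    convert! toEnd_pow_apply_mem hf hz (chainTopCoeff α β) using 2
    rw [coe_chainTop']
    simp
  obtain ⟨c, hc⟩ : ∃ c : K, c • y = (toEnd K L L f ^ chainTopCoeff α β) z := by
    simpa using (finrank_eq_one_iff_of_nonzero' ⟨y, hy⟩ (by simpa using hy₀)).mp
      (finrank_rootSpace_eq_one _ hβ) ⟨_, hmem⟩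
  apply prim.pow_toEnd_f_ne_zero_of_eq_nat rfl hle
  rw [pow_succ', Module.End.mul_apply, ← hc, map_smul, toEnd_apply_apply, hfy, smul_zero]

/-- Let `L` be a finite-dimensional Lie algebra over a field of characteristic zero with
nondegenerate Killing form, and let `H` be a splitting Cartan subalgebra.  If `α`, `ν`
and `ν + α` are roots, then every nonzero `Y` in the root space of `ν + α` admits `X` in
the root space of `-α` with `⁅X, Y⁆ ≠ 0`. -/
theorem bracket_with_neg_root_space_ne_zero
    {K L : Type*} [Field K] [CharZero K] [LieRing L] [LieAlgebra K L]
    [FiniteDimensional K L] [LieAlgebra.IsKilling K L]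
    (H : LieSubalgebra K L) [H.IsCartanSubalgebra] [LieModule.IsTriangularizable K H L]
    (α ν : Module.Dual K H)
    (hα : α ≠ 0) (hαroot : LieAlgebra.rootSpace H ⇑α ≠ ⊥)
    (hν : ν ≠ 0) (hνroot : LieAlgebra.rootSpace H ⇑ν ≠ ⊥)
    (hνα : ν + α ≠ 0) (hναroot : LieAlgebra.rootSpace H ⇑(ν + α) ≠ ⊥) :
    ∀ Y ∈ LieAlgebra.rootSpace H ⇑(ν + α), Y ≠ 0 →
      ∃ X ∈ LieAlgebra.rootSpace H (-⇑α), ⁅X, Y⁆ ≠ 0 := by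
  intro Y hY hY₀
  let a : LieModule.Weight K H L := ⟨α, hαroot⟩
  let b : LieModule.Weight K H L := ⟨⇑(ν + α), hναroot⟩
  have ha : a.IsNonZero := fun h ↦ hα (DFunLike.coe_injective h)
  have hb : b.IsNonZero := fun h ↦ hνα (DFunLike.coe_injective h)
  have hab : -⇑a + ⇑b = ⇑ν := by
    ext x
    simp [a, b]
  obtain ⟨X, hX, hXY⟩ := LieAlgebra.IsKilling.exists_mem_rootSpace_neg_forall_lie_ne_zero ha hb
    (hab ▸ hνroot)
  exact ⟨X, hX, hXY Y hY hY₀⟩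
end
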